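/- For every integer γ ≥ 1 there exists a set S of 2γ distinct labeled points of the Euclidean plane ℝ² such that: (a) some two-element subset T ⊆ S is strictly NN-consistent with S; and (b) every finite family of open Euclidean balls, each centered at a point of S and containing no point of S whose label is opposite to that of its center, such that every point of S lies in some ball of the family whose center has the same label, consists of at least 2γ balls. -/

import Mathlib

noncomputable section
open Classical

/-- The Euclidean plane. -/
abbrev Pt := EuclideanSpace ℝ (Fin 2)

/-- `T` is strictly NN-consistent with `S` (labels given by `l`): every `p ∈ S` has a
same-labeled `q ∈ T` strictly closer than every oppositely-labeled point of `T`. -/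
def StrictNNConsistent (l : Pt → Bool) (S T : Finset Pt) : Prop :=
  ∀ p ∈ S, ∃ q ∈ T, l q = l p ∧ ∀ q' ∈ T, l q' ≠ l p → dist p q < dist p q'

/-- The point in column `q.1`, on the line `y = 1` or `y = 0` according to `q.2`. -/
def gridPt (q : ℕ × Bool) : Pt := !₂[(q.1 : ℝ), if q.2 then 1 else 0]

/-- The label recording whether a point lies on the line `y = 1`. -/
def rowLabel (p : Pt) : Bool := decide (p 1 = 1)

theorem rowLabel_gridPt (q : ℕ × Bool) : rowLabel (gridPt q) = q.2 := by
  obtain ⟨i, b⟩ := q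
  cases b <;> simp [rowLabel, gridPt]

theorem gridPt_injective : Function.Injective gridPt := by
  intro p q h
  have hrow : p.2 = q.2 := by rw [← rowLabel_gridPt p, h, rowLabel_gridPt]
  have hcol : (p.1 : ℝ) = q.1 := by simpa [gridPt] using congrArg (fun x : Pt => x 0) h
  exact Prod.ext (by exact_mod_cast hcol) hrow

theorem dist_gridPt (p q : ℕ × Bool) :
    dist (gridPt p) (gridPt q) =
      Real.sqrt (((p.1 : ℝ) - q.1) ^ 2 + if p.2 = q.2 then 0 else 1) := by
  obtain ⟨i, b⟩ := p
  obtain ⟨j, c⟩ := q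
  rw [EuclideanSpace.dist_eq]
  cases b <;> cases c <;> simp [gridPt, Fin.sum_univ_two, Real.dist_eq, sq_abs]

theorem eq_of_dist_gridPt_lt_one {p q : ℕ × Bool} (hrow : p.2 = q.2)
    (h : dist (gridPt p) (gridPt q) < 1) : p = q := by
  rw [dist_gridPt, if_pos hrow, add_zero, Real.sqrt_sq_eq_abs] at h
  have hcol : |(p.1 : ℤ) - q.1| < 1 := by exact_mod_cast h
  rw [Int.abs_lt_one_iff] at hcol
  exact Prod.ext (by omega) hrow

/-- For every `γ ≥ 1` there is a set of `2γ` distinct labeled points of the plane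
that condenses to a two-point set under the (strict) NN rule, while every consistent
cover by open balls (centered at points of `S`, containing no oppositely-labeled
point, every point of `S` covered by a same-labeled ball) needs at least `2γ` balls.
A family of balls is encoded as a finite set of (center, radius) pairs. -/
theorem stmt1 (γ : ℕ) (hγ : 1 ≤ γ) :
    ∃ (S : Finset Pt) (l : Pt → Bool),
      S.card = 2 * γ ∧
      (∃ T ⊆ S, T.card = 2 ∧ StrictNNConsistent l S T) ∧
      (∀ F : Finset (Pt × ℝ),
        (∀ cr ∈ F, cr.1 ∈ S ∧ ∀ p ∈ S, l p ≠ l cr.1 → p ∉ Metric.ball cr.1 cr.2) →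
        (∀ p ∈ S, ∃ cr ∈ F, l cr.1 = l p ∧ p ∈ Metric.ball cr.1 cr.2) →
        2 * γ ≤ F.card) := by
  refine ⟨(Finset.range γ ×ˢ Finset.univ).image gridPt, rowLabel, ?_, ?_, ?_⟩
  · rw [Finset.card_image_of_injective _ gridPt_injective]
    simp [mul_comm]
  · refine ⟨({0} ×ˢ Finset.univ : Finset (ℕ × Bool)).image gridPt, ?_, ?_, ?_⟩
    · refine Finset.image_subset_image (Finset.product_subset_product_left ?_)
      simpa using Nat.lt_of_succ_le hγ
    · rw [Finset.card_image_of_injective _ gridPt_injective]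
      simp
    · intro p hp
      obtain ⟨⟨i, b⟩, -, rfl⟩ := Finset.mem_image.mp hp
      refine ⟨gridPt (0, b), Finset.mem_image_of_mem _ (by simp), ?_, ?_⟩
      · simp only [rowLabel_gridPt]
      · intro q hq hne
        obtain ⟨⟨j, c⟩, hj, rfl⟩ := Finset.mem_image.mp hq
        obtain rfl : j = 0 := Finset.mem_singleton.mp (Finset.mem_product.mp hj).1
        simp only [rowLabel_gridPt] at hne
        rw [dist_gridPt, dist_gridPt]
        refine Real.sqrt_lt_sqrt (by positivity) ?_
        simp [Ne.symm hne]
  · intro F hF hcover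
    have hcenter : (Finset.range γ ×ˢ Finset.univ).image gridPt ⊆ F.image Prod.fst := by
      intro p hp
      obtain ⟨⟨c, r⟩, hcr, hlabel, hball⟩ := hcover p hp
      obtain ⟨hc, hsep⟩ := hF _ hcr
      obtain ⟨⟨i, b⟩, -, rfl⟩ := Finset.mem_image.mp hp
      obtain ⟨⟨j, c⟩, hj, rfl⟩ := Finset.mem_image.mp hc
      simp only [rowLabel_gridPt] at hlabel
      have hr : r ≤ 1 := by
        have hopp := hsep (gridPt (j, !c))
          (Finset.mem_image_of_mem _ (by simpa using hj)) (by simp [rowLabel_gridPt])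
        simpa [dist_gridPt] using hopp
      have heq := eq_of_dist_gridPt_lt_one (p := (i, b)) (q := (j, c)) hlabel.symm
        ((Metric.mem_ball.mp hball).trans_le hr)
      exact Finset.mem_image.mpr ⟨_, hcr, congrArg gridPt heq.symm⟩
    calc 2 * γ = ((Finset.range γ ×ˢ Finset.univ).image gridPt).card := by
          rw [Finset.card_image_of_injective _ gridPt_injective]
          simp [mul_comm]
      _ ≤ (F.image Prod.fst).card := Finset.card_le_card hcenter
      _ ≤ F.card := Finset.card_image_le
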